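/- Let C be the Cartan matrix of type E₈ and C̃ the affine Cartan matrix of type E₈^{(1)} (size 9). Define simple reflections by s_i(e_j) = e_j − c_{ij} e_i in the respective standard bases, let c be the product of the 8 simple reflections of C (any fixed order) and c_a the product of the 9 simple reflections of C̃ (any fixed order). Then det(t·I − c)·(1−t)(1−t⁶)(1−t^{10})(1−t^{15}) = (1−t²)(1−t³)(1−t⁵)(1−t^{30}), det(t·I − c_a)·(1−t) = (1−t²)(1−t³)(1−t⁵), and consequently the Poincaré series p(t) = (1−t^{30})/((1−t⁶)(1−t^{10})(1−t^{15})) of the Kleinian singularity of type E₈ satisfies p(t) = det(t·I − c)/det(t·I − c_a) as rational functions. -/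

import Mathlib

open Polynomial

/-- The simple reflection `s_i` associated to a (generalized) Cartan matrix `C`,
acting on the standard basis by `s_i(e_j) = e_j - c_{ij} e_i`. -/
def simpleRefl {N : ℕ} (C : Matrix (Fin N) (Fin N) ℚ) (i : Fin N) :
    Matrix (Fin N) (Fin N) ℚ :=
  Matrix.of fun k j => (if k = j then 1 else 0) - (if k = i then C i j else 0)

/-- The Cartan matrix of type `E₈` over `ℚ`. -/
def cartanE8 : Matrix (Fin 8) (Fin 8) ℚ :=
  (CartanMatrix.E₈).map fun x => (x : ℚ)

/-- The affine Cartan matrix of type `E₈⁽¹⁾` (size 9): the `E₈` diagram with an extra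
vertex (index 8) attached to the end (index 7) of the long arm. -/
def cartanE8Affine : Matrix (Fin 9) (Fin 9) ℚ :=
  !![2, 0, -1, 0, 0, 0, 0, 0, 0;
     0, 2, 0, -1, 0, 0, 0, 0, 0;
     -1, 0, 2, -1, 0, 0, 0, 0, 0;
     0, -1, -1, 2, -1, 0, 0, 0, 0;
     0, 0, 0, -1, 2, -1, 0, 0, 0;
     0, 0, 0, 0, -1, 2, -1, 0, 0;
     0, 0, 0, 0, 0, -1, 2, -1, 0;
     0, 0, 0, 0, 0, 0, -1, 2, -1;
     0, 0, 0, 0, 0, 0, 0, -1, 2]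

section Determinant

variable {R : Type*} [CommRing R]

/-- Expansion of a determinant along a leaf of the underlying graph. -/
theorem det_eq_of_leaf {n : ℕ} (f : ℕ → ℕ → R) (hrow : ∀ i < n, f (n + 1) i = 0)
    (hcol : ∀ i < n, f i (n + 1) = 0) :
    (Matrix.of fun i j : Fin (n + 2) => f i j).det =
      f (n + 1) (n + 1) * (Matrix.of fun i j : Fin (n + 1) => f i j).det -
        f n (n + 1) * f (n + 1) n * (Matrix.of fun i j : Fin n => f i j).det := by
  have hlast : (Matrix.of fun i j : Fin (n + 2) => f i j).submatrix
      (Fin.last (n + 1)).succAbove (Fin.last (n + 1)).succAbove =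
      Matrix.of fun i j : Fin (n + 1) => f i j := by
    ext i j
    simp
  have hprev : ((Matrix.of fun i j : Fin (n + 2) => f i j).submatrix
      (Fin.last (n + 1)).succAbove (Fin.last n).castSucc.succAbove).det =
      f n (n + 1) * (Matrix.of fun i j : Fin n => f i j).det := by
    rw [Matrix.det_succ_column _ (Fin.last n), Fin.sum_univ_castSucc]
    have hsub : ((Matrix.of fun i j : Fin (n + 2) => f i j).submatrix
        (Fin.last (n + 1)).succAbove (Fin.last n).castSucc.succAbove).submatrix
        (Fin.last n).succAbove (Fin.last n).succAbove = Matrix.of fun i j : Fin n => f i j := by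
      ext i j
      simp [Fin.succAbove]
    rw [hsub]
    simp [hcol, ← two_mul]
  rw [Matrix.det_succ_row _ (Fin.last (n + 1)), Fin.sum_univ_castSucc, Fin.sum_univ_castSucc,
    hlast, hprev]
  simp [hrow, ← two_mul]
  ring

/-- The edges `0 — 2`, `1 — 3` and `i — i + 1` for `2 ≤ i` of the diagrams of type `E`,
directed from the smaller to the larger vertex. -/
abbrev EdgeE (i j : ℕ) : Prop :=
  (i = 0 ∧ j = 2) ∨ (i = 1 ∧ j = 3) ∨ (2 ≤ i ∧ j = i + 1)

/-- The entries of a matrix with constant diagonal supported on the diagram of type `E`. -/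
def entryE (d : R) (w : ℕ → ℕ → R) (i j : ℕ) : R :=
  if i = j then d else if EdgeE i j ∨ EdgeE j i then -w i j else 0

/-- The matrix of size `n` with constant diagonal, supported on the diagram of type `Eₙ`. -/
def matrixE (d : R) (w : ℕ → ℕ → R) (n : ℕ) : Matrix (Fin n) (Fin n) R :=
  Matrix.of fun i j => entryE d w i j

variable {d x : R} {w : ℕ → ℕ → R}

theorem det_matrixE_add_two (hw : ∀ i j, i ≠ j → w i j * w j i = x) {n : ℕ} (hn : 4 ≤ n) :
    (matrixE d w (n + 2)).det = d * (matrixE d w (n + 1)).det - x * (matrixE d w n).det := by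
  rw [matrixE, det_eq_of_leaf (entryE d w)]
  · have h₁ : EdgeE n (n + 1) := by grind
    simp only [h₁, true_or, or_true, if_true, Nat.succ_ne_self, (Nat.succ_ne_self n).symm,
      if_false, neg_mul_neg, entryE, hw n (n + 1) (by omega), matrixE]
  · intro i hi
    rw [entryE, if_neg (by omega), if_neg (by grind)]
  · intro i hi
    rw [entryE, if_neg (by omega), if_neg (by grind)]

theorem det_matrixE_four (hw : ∀ i j, i ≠ j → w i j * w j i = x) :
    (matrixE d w 4).det = d ^ 4 - 3 * x * d ^ 2 + x ^ 2 := by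
  have h₀₂ := hw 0 2 (by decide)
  have h₁₃ := hw 1 3 (by decide)
  have h₂₃ := hw 2 3 (by decide)
  simp [matrixE, entryE, Matrix.det_succ_row_zero, Fin.sum_univ_succ, Fin.succAbove, EdgeE]
  grind

theorem det_matrixE_five (hw : ∀ i j, i ≠ j → w i j * w j i = x) :
    (matrixE d w 5).det = d ^ 5 - 4 * x * d ^ 3 + 2 * x ^ 2 * d := by
  have h₀₂ := hw 0 2 (by decide)
  have h₁₃ := hw 1 3 (by decide)
  have h₂₃ := hw 2 3 (by decide)
  have h₃₄ := hw 3 4 (by decide)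
  simp [matrixE, entryE, Matrix.det_succ_row_zero, Fin.sum_univ_succ, Fin.succAbove, EdgeE]
  grind

theorem det_matrixE_eight (hw : ∀ i j, i ≠ j → w i j * w j i = x) :
    (matrixE d w 8).det =
      d ^ 8 - 7 * x * d ^ 6 + 14 * x ^ 2 * d ^ 4 - 8 * x ^ 3 * d ^ 2 + x ^ 4 := by
  rw [det_matrixE_add_two hw (n := 6) (by norm_num), det_matrixE_add_two hw (n := 5) (by norm_num),
    det_matrixE_add_two hw (n := 4) (by norm_num), det_matrixE_five hw, det_matrixE_four hw]
  ring

theorem det_matrixE_nine (hw : ∀ i j, i ≠ j → w i j * w j i = x) :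
    (matrixE d w 9).det =
      d ^ 9 - 8 * x * d ^ 7 + 20 * x ^ 2 * d ^ 5 - 17 * x ^ 3 * d ^ 3 + 4 * x ^ 4 * d := by
  rw [det_matrixE_add_two hw (n := 7) (by norm_num), det_matrixE_eight hw,
    det_matrixE_add_two hw (n := 5) (by norm_num),
    det_matrixE_add_two hw (n := 4) (by norm_num), det_matrixE_five hw, det_matrixE_four hw]
  ring

end Determinant

/-- The coefficient of `A i j` in the matrix `t U + L` for the order given by `σ`, extended to
all natural numbers. -/
noncomputable def orderWeight {N : ℕ} (σ : Equiv.Perm (Fin N)) (i j : ℕ) : ℚ[X] :=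
  if h : i < N ∧ j < N then if σ.symm ⟨i, h.1⟩ < σ.symm ⟨j, h.2⟩ then X else 1
  else if i < j then X else 1

theorem orderWeight_mul {N : ℕ} (σ : Equiv.Perm (Fin N)) (i j : ℕ) (h : i ≠ j) :
    orderWeight σ i j * orderWeight σ j i = X := by
  by_cases hN : i < N ∧ j < N
  · have hne : σ.symm ⟨i, hN.1⟩ ≠ σ.symm ⟨j, hN.2⟩ := by simpa using h
    rcases lt_or_gt_of_ne hne with h' | h' <;> simp [orderWeight, hN, h', h'.not_gt]
  · have hN' : ¬(j < N ∧ i < N) := fun h' => hN h'.symm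
    rcases lt_or_gt_of_ne h with h' | h' <;> simp [orderWeight, hN, hN', h', h'.not_gt]

section Reflections

variable {N : ℕ} (A : Matrix (Fin N) (Fin N) ℚ)

theorem simpleRefl_mul_apply (M : Matrix (Fin N) (Fin N) ℚ) (i k j : Fin N) :
    (simpleRefl A i * M) k j = M k j - if k = i then ∑ m, A i m * M m j else 0 := by
  simp only [simpleRefl, Matrix.mul_apply, Matrix.of_apply, sub_mul, Finset.sum_sub_distrib,
    ite_mul, one_mul, zero_mul, Finset.sum_ite_eq, Finset.mem_univ, if_true]
  split_ifs <;> simp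

/-- Reflections in basis vectors other than `e_i` leave the `i`-th row unchanged. -/
theorem prod_simpleRefl_mul_apply_of_notMem (M : Matrix (Fin N) (Fin N) ℚ) (i j : Fin N)
    (l : List (Fin N)) (hi : i ∉ l) : ((l.map (simpleRefl A)).prod * M) i j = M i j := by
  induction l with
  | nil => simp
  | cons a l ih =>
    rw [List.mem_cons, not_or] at hi
    rw [List.map_cons, List.prod_cons, Matrix.mul_assoc, simpleRefl_mul_apply, if_neg hi.1,
      sub_zero, ih hi.2]

theorem prod_simpleRefl_append_cons_apply (l₁ l₂ : List (Fin N)) (i j : Fin N)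
    (h : (l₁ ++ i :: l₂).Nodup) :
    ((l₁ ++ i :: l₂).map (simpleRefl A)).prod i j =
      (1 : Matrix (Fin N) (Fin N) ℚ) i j - ∑ m, A i m *
        if m ∈ l₂ then ((l₁ ++ i :: l₂).map (simpleRefl A)).prod m j
        else (1 : Matrix (Fin N) (Fin N) ℚ) m j := by
  obtain ⟨-, h₂, h₁₂⟩ := List.nodup_append.1 h
  have hi : i ∉ l₂ := (List.nodup_cons.1 h₂).1
  have hi₁ : i ∉ l₁ := fun hm => h₁₂ i hm i (by simp) rfl
  have fixed (m : Fin N) (hm : m ∉ l₂) : (l₂.map (simpleRefl A)).prod m j =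
      (1 : Matrix (Fin N) (Fin N) ℚ) m j := by
    simpa using prod_simpleRefl_mul_apply_of_notMem A 1 m j l₂ hm
  have moved (m : Fin N) (hm : m ∈ l₂) : ((l₁ ++ i :: l₂).map (simpleRefl A)).prod m j =
      (l₂.map (simpleRefl A)).prod m j := by
    have hm₁ : m ∉ l₁ := fun h' => h₁₂ m h' m (by simp [hm]) rfl
    have hmi : m ≠ i := fun h' => hi (h' ▸ hm)
    rw [List.map_append, List.prod_append, prod_simpleRefl_mul_apply_of_notMem A _ m j l₁ hm₁,
      List.map_cons, List.prod_cons, simpleRefl_mul_apply, if_neg hmi, sub_zero]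
  have hsum : (∑ m, A i m * if m ∈ l₂ then ((l₁ ++ i :: l₂).map (simpleRefl A)).prod m j
      else (1 : Matrix (Fin N) (Fin N) ℚ) m j) =
      ∑ m, A i m * (l₂.map (simpleRefl A)).prod m j := by
    refine Finset.sum_congr rfl fun m _ => ?_
    split_ifs with hm
    · rw [moved m hm]
    · rw [fixed m hm]
  rw [hsum, List.map_append, List.prod_append,
    prod_simpleRefl_mul_apply_of_notMem A _ i j l₁ hi₁,
    List.map_cons, List.prod_cons, simpleRefl_mul_apply, if_pos rfl, fixed i hi]

/-- The part of `A` strictly above the diagonal in the order given by `σ`, plus the identity. -/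
def upperPart (σ : Equiv.Perm (Fin N)) : Matrix (Fin N) (Fin N) ℚ :=
  Matrix.of fun i j => if i = j then 1 else if σ.symm i < σ.symm j then A i j else 0

/-- The part of `A` strictly below the diagonal in the order given by `σ`, plus the identity. -/
def lowerPart (σ : Equiv.Perm (Fin N)) : Matrix (Fin N) (Fin N) ℚ :=
  Matrix.of fun i j => if i = j then 1 else if σ.symm j < σ.symm i then A i j else 0

theorem det_upperPart (σ : Equiv.Perm (Fin N)) : (upperPart A σ).det = 1 := by
  rw [← Matrix.det_submatrix_equiv_self σ, Matrix.det_of_isUpperTriangular]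
  · simp [upperPart]
  · intro i j hij
    have hij : j < i := hij
    simp [upperPart, hij.ne', hij.not_gt]

/-- A Coxeter element `c` satisfies `U c = -L`, where `A = U + L` is the decomposition into
unipotent triangular parts with respect to the order of the factors. -/
theorem upperPart_mul_coxeter (hA : ∀ i, A i i = 2) (σ : Equiv.Perm (Fin N)) :
    upperPart A σ * (List.ofFn fun k => simpleRefl A (σ k)).prod = -lowerPart A σ := by
  ext i j
  obtain ⟨p, rfl⟩ := σ.surjective i
  set l := List.ofFn σ with hl
  have hlen : l.length = N := by simp [hl]
  have hmap : (List.ofFn fun k => simpleRefl A (σ k)) = l.map (simpleRefl A) := by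
    rw [hl, List.map_ofFn]; rfl
  have hsplit : l.take p ++ σ p :: l.drop (p + 1) = l := by
    have hp : l[(p : ℕ)]'(by rw [hlen]; exact p.2) = σ p := by simp [hl]
    rw [← hp, List.cons_getElem_drop_succ, List.take_append_drop]
  have hnodup : l.Nodup := List.nodup_ofFn.2 σ.injective
  have hmem (m : Fin N) : m ∈ l.drop (p + 1) ↔ p < σ.symm m := by
    rw [List.mem_drop_iff_getElem]
    constructor
    · rintro ⟨k, hk, rfl⟩
      simp only [hl, List.getElem_ofFn, Equiv.symm_apply_apply, Fin.lt_def]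
      omega
    · intro h
      have h' : (p : ℕ) < σ.symm m := h
      have h'' := (σ.symm m).2
      refine ⟨(σ.symm m : ℕ) - (p + 1), by omega, ?_⟩
      have : (p : ℕ) + 1 + ((σ.symm m : ℕ) - (p + 1)) = σ.symm m := by omega
      simp [hl, this]
  have key := prod_simpleRefl_append_cons_apply A (l.take p) (l.drop (p + 1)) (σ p) j
    (by rwa [hsplit])
  rw [hsplit] at key
  simp only [hmem] at key
  rw [hmap, Matrix.mul_apply]
  set Q := (l.map (simpleRefl A)).prod
  have hterm (m : Fin N) : upperPart A σ (σ p) m * Q m j =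
      (if σ p = m then Q m j else 0) + (A (σ p) m * (if p < σ.symm m then Q m j
        else (1 : Matrix (Fin N) (Fin N) ℚ) m j))
        - (lowerPart A σ (σ p) m + if σ p = m then 1 else 0)
          * (1 : Matrix (Fin N) (Fin N) ℚ) m j := by
    simp only [upperPart, lowerPart, Matrix.of_apply, Equiv.symm_apply_apply]
    by_cases h : σ p = m
    · subst h
      simp [hA]
      ring
    · have hne : p ≠ σ.symm m := fun h' => h (by simp [h'])
      rcases lt_or_gt_of_ne hne with h' | h'
      · simp [h, h', h'.not_gt]
      · simp [h, h', h'.not_gt]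
  simp only [hterm, Finset.sum_sub_distrib, Finset.sum_add_distrib]
  rw [eq_sub_iff_add_eq] at key
  simp only [Finset.sum_ite_eq, Finset.mem_univ, if_true]
  rw [key]
  simp [Matrix.one_apply]

/-- The characteristic polynomial of a Coxeter element is `det (t U + L)`. -/
theorem charpoly_coxeter (hA : ∀ i, A i i = 2) (σ : Equiv.Perm (Fin N)) :
    (List.ofFn fun k => simpleRefl A (σ k)).prod.charpoly =
      (Matrix.of fun i j : Fin N => if i = j then X + 1 else
        orderWeight σ i j * C (A i j)).det := by
  have hU : ((upperPart A σ).map (C : ℚ →+* ℚ[X])).det = 1 := by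
    have := (RingHom.map_det (C : ℚ →+* ℚ[X]) (upperPart A σ)).symm
    rwa [det_upperPart, map_one] at this
  have hmul (Q : Matrix (Fin N) (Fin N) ℚ) : Q.charpoly =
      ((upperPart A σ).map (C : ℚ →+* ℚ[X]) * Q.charmatrix).det := by
    rw [Matrix.det_mul, hU, one_mul, Matrix.charpoly]
  rw [hmul]
  refine congrArg Matrix.det ?_
  rw [Matrix.charmatrix, mul_sub, RingHom.mapMatrix_apply, ← Matrix.map_mul,
    upperPart_mul_coxeter A hA]
  ext1 i j
  simp only [upperPart, lowerPart, Matrix.scalar_apply, Matrix.mul_diagonal, Matrix.map_apply,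
    Matrix.neg_apply, Matrix.of_apply, Matrix.sub_apply]
  by_cases h : i = j
  · simp [h]
  · have hne : σ.symm i ≠ σ.symm j := fun h' => h (σ.symm.injective h')
    rcases lt_or_gt_of_ne hne with h' | h'
    · simp [orderWeight, h, h', h'.not_gt]
    · simp [orderWeight, h, h', h'.not_gt]

end Reflections

theorem charpoly_coxeterE8 (σ : Equiv.Perm (Fin 8)) :
    (List.ofFn fun k => simpleRefl cartanE8 (σ k)).prod.charpoly =
      X ^ 8 + X ^ 7 - X ^ 5 - X ^ 4 - X ^ 3 + X + 1 := by
  rw [charpoly_coxeter _ (by intro i; fin_cases i <;> simp [cartanE8, CartanMatrix.E₈])]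
  have hM : (Matrix.of fun i j : Fin 8 => if i = j then X + 1 else
      orderWeight σ i j * C (cartanE8 i j)) = matrixE (X + 1) (orderWeight σ) 8 := by
    ext1 i j
    fin_cases i <;> fin_cases j <;> simp [cartanE8, CartanMatrix.E₈, matrixE, entryE]
  rw [hM, det_matrixE_eight (orderWeight_mul σ)]
  ring

theorem charpoly_coxeterE8Affine (σ : Equiv.Perm (Fin 9)) :
    (List.ofFn fun k => simpleRefl cartanE8Affine (σ k)).prod.charpoly =
      X ^ 9 + X ^ 8 - X ^ 6 - X ^ 5 - X ^ 4 - X ^ 3 + X + 1 := by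
  rw [charpoly_coxeter _ (by intro i; fin_cases i <;> simp [cartanE8Affine])]
  have hM : (Matrix.of fun i j : Fin 9 => if i = j then X + 1 else
      orderWeight σ i j * C (cartanE8Affine i j)) = matrixE (X + 1) (orderWeight σ) 9 := by
    ext1 i j
    fin_cases i <;> fin_cases j <;> simp [cartanE8Affine, matrixE, entryE]
  rw [hM, det_matrixE_nine (orderWeight_mul σ)]
  ring

theorem one_sub_X_pow_ne_zero {n : ℕ} (hn : n ≠ 0) : (1 - X ^ n : ℚ[X]) ≠ 0 := fun h => by
  simpa [hn] using congrArg (eval 0) h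

theorem ratFunc_div_eq_div {p q : ℚ[X]} (hq : q ≠ 0)
    (h : (1 - X ^ 30) * q = p * ((1 - X ^ 6) * (1 - X ^ 10) * (1 - X ^ 15))) :
    (1 - RatFunc.X ^ 30) / ((1 - RatFunc.X ^ 6) * (1 - RatFunc.X ^ 10) * (1 - RatFunc.X ^ 15)) =
      algebraMap ℚ[X] (RatFunc ℚ) p / algebraMap ℚ[X] (RatFunc ℚ) q := by
  have hden : ((1 - X ^ 6) * (1 - X ^ 10) * (1 - X ^ 15) : ℚ[X]) ≠ 0 :=
    mul_ne_zero (mul_ne_zero (one_sub_X_pow_ne_zero (by decide))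
      (one_sub_X_pow_ne_zero (by decide))) (one_sub_X_pow_ne_zero (by decide))
  have hmap := congrArg (algebraMap ℚ[X] (RatFunc ℚ)) h
  have hden' := RatFunc.algebraMap_ne_zero hden
  simp only [map_mul, map_sub, map_one, map_pow, RatFunc.algebraMap_X] at hden' hmap
  exact (div_eq_div_iff hden' (RatFunc.algebraMap_ne_zero hq)).2 hmap

theorem mul_eq_mul_of_identities {p q : ℚ[X]}
    (hp : p * ((1 - X) * (1 - X ^ 6) * (1 - X ^ 10) * (1 - X ^ 15)) =
      (1 - X ^ 2) * (1 - X ^ 3) * (1 - X ^ 5) * (1 - X ^ 30))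
    (hq : q * (1 - X) = (1 - X ^ 2) * (1 - X ^ 3) * (1 - X ^ 5)) :
    (1 - X ^ 30) * q = p * ((1 - X ^ 6) * (1 - X ^ 10) * (1 - X ^ 15)) := by
  have h : (1 - X : ℚ[X]) ≠ 0 := by simpa using one_sub_X_pow_ne_zero one_ne_zero
  exact mul_right_cancel₀ h (by linear_combination (1 - X ^ 30) * hq - hp)

/-- Theorem 2 for type `E₈`: any Coxeter element `c` (product of the 8 simple
reflections of the `E₈` Cartan matrix in any fixed order) and any affine Coxeter
element `c_a` (product of the 9 simple reflections of the affine `E₈⁽¹⁾` Cartan matrix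
in any fixed order) satisfy
`det(tI-c)·(1-t)(1-t⁶)(1-t¹⁰)(1-t¹⁵) = (1-t²)(1-t³)(1-t⁵)(1-t³⁰)`,
`det(tI-c_a)·(1-t) = (1-t²)(1-t³)(1-t⁵)`, and the Poincaré series
`p(t) = (1-t³⁰)/((1-t⁶)(1-t¹⁰)(1-t¹⁵))` of the Kleinian singularity of type `E₈`
equals `det(tI-c)/det(tI-c_a)` as a rational function. -/
theorem poincare_series_E8
    (σ : Equiv.Perm (Fin 8)) (τ : Equiv.Perm (Fin 9))
    (c : Matrix (Fin 8) (Fin 8) ℚ)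
    (hc : c = (List.ofFn fun k => simpleRefl cartanE8 (σ k)).prod)
    (ca : Matrix (Fin 9) (Fin 9) ℚ)
    (hca : ca = (List.ofFn fun k => simpleRefl cartanE8Affine (τ k)).prod) :
    c.charpoly * ((1 - X) * (1 - X ^ 6) * (1 - X ^ 10) * (1 - X ^ 15))
      = (1 - X ^ 2) * (1 - X ^ 3) * (1 - X ^ 5) * (1 - X ^ 30) ∧
    ca.charpoly * (1 - X) = (1 - X ^ 2) * (1 - X ^ 3) * (1 - X ^ 5) ∧
    (1 - RatFunc.X ^ 30) /
        ((1 - RatFunc.X ^ 6) * (1 - RatFunc.X ^ 10) * (1 - RatFunc.X ^ 15))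
      = algebraMap (Polynomial ℚ) (RatFunc ℚ) c.charpoly /
        algebraMap (Polynomial ℚ) (RatFunc ℚ) ca.charpoly := by
  have h₁ : c.charpoly * ((1 - X) * (1 - X ^ 6) * (1 - X ^ 10) * (1 - X ^ 15)) =
      (1 - X ^ 2) * (1 - X ^ 3) * (1 - X ^ 5) * (1 - X ^ 30) := by
    rw [hc, charpoly_coxeterE8]
    ring
  have h₂ : ca.charpoly * (1 - X) = (1 - X ^ 2) * (1 - X ^ 3) * (1 - X ^ 5) := by
    rw [hca, charpoly_coxeterE8Affine]
    ring
  exact ⟨h₁, h₂, ratFunc_div_eq_div ca.charpoly_monic.ne_zero (mul_eq_mul_of_identities h₁ h₂)⟩
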